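/- For every C with 0 < C ≤ 1, the quantity q(C) = Σ_{r=1}^{∞} T_r C^{r−1} e^{−Cr}/(r−1)! equals 1. -/

import Mathlib

/-- `treeTerm C s = T_s C^(s-1) e^(-C s) / (s-1)!` where `T_s = s^(s-2)` is the number of
labelled trees on `s` vertices (with `T_1 = 1`, using truncated subtraction). -/
noncomputable def treeTerm (C : ℝ) (s : ℕ) : ℝ :=
  ((s ^ (s - 2) : ℕ) : ℝ) * C ^ (s - 1) * Real.exp (-C * s) / (Nat.factorial (s - 1))

/-- `q(C) = ∑_{s=1}^∞ T_s C^(s-1) e^(-C s)/(s-1)!`. -/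
noncomputable def qfun (C : ℝ) : ℝ := ∑' r : ℕ, treeTerm C (r + 1)

open Finset in
/-- Alternating binomial sum obtained by expanding the exponentials in the tree series. -/
theorem sum_antidiagonal_pow_mul_neg_pow_div_factorial {n : ℕ} (hn : n ≠ 0) :
    ∑ p ∈ antidiagonal n, ((p.1 + 1 : ℕ) : ℝ) ^ p.1 / ((p.1 + 1).factorial : ℝ) *
      ((-((p.1 + 1 : ℕ) : ℝ)) ^ p.2 / (p.2.factorial : ℝ)) = 0 := by
  have h := congrFun (fwdDiff_iter_pow_eq_zero_of_lt (R := ℝ) (Nat.lt_succ_self n)) 0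
  rw [fwdDiff_iter_eq_sum_shift, sum_range_succ'] at h
  simp only [Pi.zero_apply, zero_smul, add_zero, zero_pow hn, smul_zero, zero_add,
    nsmul_eq_mul, mul_one, zsmul_eq_mul] at h
  rw [Finset.Nat.sum_antidiagonal_eq_sum_range_succ_mk]
  have hf : ((n + 1).factorial : ℝ) ≠ 0 := by positivity
  refine (mul_eq_zero.mp ?_).resolve_left hf
  rw [mul_sum, ← h]
  refine sum_congr rfl fun k hk ↦ ?_
  have hk' : k ≤ n := Nat.lt_succ_iff.mp (mem_range.mp hk)
  have hch : ((n + 1).choose (k + 1) : ℝ) * (k + 1).factorial * (n - k).factorial =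
      (n + 1).factorial := by
    have := Nat.choose_mul_factorial_mul_factorial (Nat.succ_le_succ hk')
    rw [Nat.succ_sub_succ] at this
    exact_mod_cast this
  have hpow : (((k + 1 : ℕ) : ℝ)) ^ n = ((k + 1 : ℕ) : ℝ) ^ k * ((k + 1 : ℕ) : ℝ) ^ (n - k) := by
    rw [← pow_add, Nat.add_sub_cancel' hk']
  rw [← hch, neg_pow, hpow, Nat.succ_sub_succ]
  push_cast
  field_simp

/-- The coefficients of the tree function `T(x) / x = ∑ (n + 1) ^ n / (n + 1)! * x ^ n`. -/
noncomputable def treeCoeff (n : ℕ) : ℝ := ((n + 1 : ℕ) : ℝ) ^ n / ((n + 1).factorial : ℝ)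

theorem treeCoeff_nonneg (n : ℕ) : 0 ≤ treeCoeff n := by
  unfold treeCoeff; positivity

theorem treeCoeff_le_exp (n : ℕ) : treeCoeff n ≤ Real.exp (n + 1 : ℕ) := by
  refine le_trans ?_ (Real.pow_div_factorial_le_exp (x := (n + 1 : ℕ)) (by positivity) (n + 1))
  unfold treeCoeff
  gcongr
  · exact_mod_cast Nat.succ_le_succ (Nat.zero_le n)
  · exact Nat.le_succ n

theorem treeTerm_succ (C : ℝ) (n : ℕ) :
    treeTerm C (n + 1) = Real.exp (-C) * (treeCoeff n * (C * Real.exp (-C)) ^ n) := by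
  have he : Real.exp (-C * (n + 1 : ℕ)) = Real.exp (-C) * Real.exp (-C) ^ n := by
    rw [mul_comm, Real.exp_nat_mul, pow_succ']
  have hp : (((n + 1) ^ (n - 1) : ℕ) : ℝ) * ((n + 1).factorial : ℝ) =
      ((n + 1 : ℕ) : ℝ) ^ n * (n.factorial : ℝ) := by
    cases n with
    | zero => simp
    | succ m =>
      rw [Nat.factorial_succ (m + 1)]
      push_cast
      ring
  have hf : ((n + 1).factorial : ℝ) ≠ 0 := by positivity
  have hf' : (n.factorial : ℝ) ≠ 0 := by positivity
  have hq : (((n + 1) ^ (n - 1) : ℕ) : ℝ) / (n.factorial : ℝ) = treeCoeff n := by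
    rw [treeCoeff, div_eq_div_iff hf' hf, hp]
  rw [treeTerm, he, ← hq, mul_pow, show n + 1 - 2 = n - 1 by omega, Nat.add_sub_cancel]
  ring

/-- The tree function divided by its argument. -/
noncomputable def treeSeries (x : ℝ) : ℝ := ∑' n, treeCoeff n * x ^ n

theorem qfun_eq_exp_neg_mul_treeSeries (C : ℝ) :
    qfun C = Real.exp (-C) * treeSeries (C * Real.exp (-C)) := by
  simp_rw [qfun, treeTerm_succ, tsum_mul_left, treeSeries]

theorem summable_treeCoeff_mul_pow {x : ℝ} (hx0 : 0 ≤ x) (hx : x < Real.exp (-1)) :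
    Summable fun n ↦ treeCoeff n * x ^ n := by
  have hx1 : Real.exp 1 * x < 1 := by
    calc Real.exp 1 * x < Real.exp 1 * Real.exp (-1) := by gcongr
      _ = 1 := by rw [← Real.exp_add]; simp
  refine Summable.of_nonneg_of_le (fun n ↦ mul_nonneg (treeCoeff_nonneg n) (by positivity))
    (fun n ↦ ?_) ((summable_geometric_of_lt_one (by positivity) hx1).mul_left (Real.exp 1))
  calc treeCoeff n * x ^ n ≤ Real.exp (n + 1 : ℕ) * x ^ n := by
        gcongr; exact treeCoeff_le_exp n
    _ = Real.exp 1 * (Real.exp 1 * x) ^ n := by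
        rw [← mul_one ((n + 1 : ℕ) : ℝ), Real.exp_nat_mul]; ring

theorem analyticOnNhd_treeSeries :
    AnalyticOnNhd ℝ treeSeries (Metric.ball 0 (Real.exp (-1))) := by
  set p := FormalMultilinearSeries.ofScalars ℝ treeCoeff
  let r : NNReal := ⟨Real.exp (-1), (Real.exp_pos _).le⟩
  have hr : (r : ENNReal) ≤ p.radius := by
    refine p.le_radius_of_bound (Real.exp 1) fun n ↦ ?_
    rw [FormalMultilinearSeries.ofScalars_norm, Real.norm_of_nonneg (treeCoeff_nonneg n)]
    calc treeCoeff n * Real.exp (-1) ^ n ≤ Real.exp (n + 1 : ℕ) * Real.exp (-1) ^ n := by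
          gcongr; exact treeCoeff_le_exp n
      _ = Real.exp 1 := by
          rw [← Real.exp_nat_mul, ← Real.exp_add]; push_cast; ring_nf
  have hsum : p.sum = treeSeries := by
    ext x
    simp [p, FormalMultilinearSeries.sum, treeSeries, mul_comm]
  have hpos : 0 < p.radius := lt_of_lt_of_le (ENNReal.coe_pos.mpr (Real.exp_pos (-1))) hr
  intro x hx
  rw [← hsum]
  refine p.hasFPowerSeriesOnBall hpos |>.analyticAt_of_mem (Metric.eball_subset_eball hr ?_)
  rw [Metric.mem_eball, edist_nndist]
  exact ENNReal.coe_lt_coe.mpr hx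

theorem mul_exp_neg_lt_exp_neg_one {C : ℝ} (hC : C ≠ 1) :
    C * Real.exp (-C) < Real.exp (-1) := by
  have h := Real.add_one_lt_exp (sub_ne_zero.mpr hC)
  rw [sub_add_cancel] at h
  calc C * Real.exp (-C) < Real.exp (C - 1) * Real.exp (-C) := by gcongr
    _ = Real.exp (-1) := by rw [← Real.exp_add]; ring_nf

open Finset in
/-- For small `C` the double series obtained by expanding the exponentials converges absolutely. -/
theorem qfun_eq_one_of_lt {C : ℝ} (hC0 : 0 < C) (hC : C < 1 / 8) : qfun C = 1 := by
  let F : ℕ × ℕ → ℝ := fun p ↦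
    treeCoeff p.1 * C ^ p.1 * ((-(C * (p.1 + 1 : ℕ))) ^ p.2 / (p.2.factorial : ℝ))
  have hexp (y : ℝ) : HasSum (fun n ↦ y ^ n / (n.factorial : ℝ)) (Real.exp y) := by
    rw [Real.exp_eq_exp_ℝ]; exact NormedSpace.expSeries_div_hasSum_exp y
  have hrow (n : ℕ) : HasSum (fun k ↦ F (n, k)) (treeTerm C (n + 1)) := by
    have h := (hexp (-(C * (n + 1 : ℕ)))).mul_left (treeCoeff n * C ^ n)
    have he : treeTerm C (n + 1) = treeCoeff n * C ^ n * Real.exp (-(C * (n + 1 : ℕ))) := by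
      rw [treeTerm_succ, mul_pow, show -(C * (n + 1 : ℕ)) = (n + 1 : ℕ) * (-C) by ring,
        Real.exp_nat_mul]
      ring
    rwa [he]
  have hrow' (n : ℕ) : HasSum (fun k ↦ ‖F (n, k)‖)
      (treeCoeff n * C ^ n * Real.exp (C * (n + 1 : ℕ))) := by
    refine ((hexp (C * (n + 1 : ℕ))).mul_left (treeCoeff n * C ^ n)).congr_fun fun k ↦ ?_
    simp only [F, norm_mul, norm_div, norm_pow, norm_neg, Real.norm_of_nonneg (treeCoeff_nonneg n),
      Real.norm_of_nonneg hC0.le, Real.norm_natCast]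
  have hx : C * Real.exp C < Real.exp (-1) := by
    have h1 : Real.exp (1 + C) < 8 := by
      calc Real.exp (1 + C) ≤ Real.exp 2 := by gcongr; linarith
        _ = Real.exp 1 * Real.exp 1 := by rw [← Real.exp_add]; norm_num
        _ < 8 := by nlinarith [Real.exp_one_lt_d9, Real.exp_pos 1]
    have h2 : Real.exp C = Real.exp (1 + C) * Real.exp (-1) := by
      rw [← Real.exp_add]; ring_nf
    rw [h2]
    have : C * Real.exp (1 + C) < 1 := by nlinarith
    nlinarith [Real.exp_pos (-1)]
  have hF : Summable F := by
    refine Summable.of_norm ((summable_prod_of_nonneg fun _ ↦ norm_nonneg _).mpr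
      ⟨fun n ↦ (hrow' n).summable, ?_⟩)
    simp_rw [fun n ↦ (hrow' n).tsum_eq]
    refine ((summable_treeCoeff_mul_pow (by positivity) hx).mul_left (Real.exp C)).congr fun n ↦ ?_
    rw [mul_comm C ((n + 1 : ℕ) : ℝ), Real.exp_nat_mul]
    ring
  have hdiag : HasSum (fun n ↦ ∑ p ∈ antidiagonal n, F p) (∑' p, F p) := by
    have h := (HasAntidiagonal.sigmaAntidiagonalEquivProd (A := ℕ)).hasSum_iff.mpr hF.hasSum
    convert h.sigma fun n ↦ hasSum_fintype _ using 2 with n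
    exact (Finset.sum_coe_sort (antidiagonal n) F).symm
  have hzero (n : ℕ) (hn : n ≠ 0) : ∑ p ∈ antidiagonal n, F p = 0 := by
    rw [← mul_zero (C ^ n), ← sum_antidiagonal_pow_mul_neg_pow_div_factorial hn, mul_sum]
    refine sum_congr rfl fun p hp ↦ ?_
    rw [← mem_antidiagonal.mp hp, pow_add]
    simp only [F, treeCoeff]
    rw [neg_pow (C * _), mul_pow, neg_pow ((p.1 + 1 : ℕ) : ℝ)]
    ring
  have h1 : ∑' p, F p = 1 := by
    rw [← hdiag.tsum_eq, tsum_eq_single 0 hzero]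
    simp [F, treeCoeff]
  rw [qfun, ← h1, hF.tsum_prod' fun n ↦ (hrow n).summable]
  exact tsum_congr fun n ↦ (hrow n).tsum_eq.symm

/-- Analytic continuation from small `C` to the open unit interval. -/
theorem treeSeries_mul_exp_neg_eqOn :
    Set.EqOn (fun C ↦ treeSeries (C * Real.exp (-C))) Real.exp (Set.Ioo 0 1) := by
  have hf : AnalyticOnNhd ℝ (fun C ↦ treeSeries (C * Real.exp (-C))) (Set.Ioo 0 1) := by
    intro C hC
    refine AnalyticAt.fun_comp (g := treeSeries) (analyticOnNhd_treeSeries _ ?_) (by fun_prop)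
    rw [mem_ball_zero_iff, Real.norm_of_nonneg (mul_nonneg hC.1.le (Real.exp_pos _).le)]
    exact mul_exp_neg_lt_exp_neg_one hC.2.ne
  refine hf.eqOn_of_preconnected_of_eventuallyEq (fun C _ ↦ by fun_prop) isPreconnected_Ioo
    (z₀ := 1 / 16) (by norm_num) ?_
  filter_upwards [Ioo_mem_nhds (show (0 : ℝ) < 1 / 16 by norm_num)
    (show (1 / 16 : ℝ) < 1 / 8 by norm_num)] with C hC
  have h := qfun_eq_one_of_lt hC.1 hC.2
  rw [qfun_eq_exp_neg_mul_treeSeries] at h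
  rw [← mul_one (Real.exp C), ← h, ← mul_assoc, ← Real.exp_add, add_neg_cancel, Real.exp_zero,
    one_mul]

theorem summable_treeCoeff_mul_exp_neg_one_pow :
    Summable fun n ↦ treeCoeff n * Real.exp (-1) ^ n := by
  refine summable_of_sum_range_le (c := Real.exp 1)
    (fun n ↦ mul_nonneg (treeCoeff_nonneg n) (by positivity)) fun N ↦ ?_
  have h := le_on_closure (s := Set.Ioo (0 : ℝ) 1)
    (f := fun C ↦ ∑ n ∈ Finset.range N, treeCoeff n * (C * Real.exp (-C)) ^ n)
    (g := Real.exp) (fun C hC ↦ ?_) (by fun_prop) (by fun_prop)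
    (x := 1) (by rw [closure_Ioo zero_ne_one]; simp)
  · simpa using h
  · have h0 : 0 ≤ C * Real.exp (-C) := mul_nonneg hC.1.le (Real.exp_pos _).le
    rw [← treeSeries_mul_exp_neg_eqOn hC]
    exact (summable_treeCoeff_mul_pow h0 (mul_exp_neg_lt_exp_neg_one hC.2.ne)).sum_le_tsum _
      fun n _ ↦ mul_nonneg (treeCoeff_nonneg n) (by positivity)

theorem treeSeries_mul_exp_neg_eq_exp {C : ℝ} (hC : C ∈ Set.Icc (0 : ℝ) 1) :
    treeSeries (C * Real.exp (-C)) = Real.exp C := by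
  refine treeSeries_mul_exp_neg_eqOn.of_subset_closure ?_ (by fun_prop) Set.Ioo_subset_Icc_self
    (closure_Ioo zero_ne_one).ge hC
  refine continuousOn_tsum (fun n ↦ by fun_prop) summable_treeCoeff_mul_exp_neg_one_pow
    fun n x hx ↦ ?_
  have h0 : 0 ≤ x * Real.exp (-x) := mul_nonneg hx.1 (Real.exp_pos _).le
  rw [Real.norm_of_nonneg (mul_nonneg (treeCoeff_nonneg n) (by positivity))]
  gcongr
  · exact treeCoeff_nonneg n
  · exact Real.mul_exp_neg_le_exp_neg_one x

/-- For every `0 < C ≤ 1` we have `q(C) = 1`. -/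
theorem qfun_eq_one (C : ℝ) (hC0 : 0 < C) (hC1 : C ≤ 1) : qfun C = 1 := by
  rw [qfun_eq_exp_neg_mul_treeSeries, treeSeries_mul_exp_neg_eq_exp ⟨hC0.le, hC1⟩, ← Real.exp_add,
    neg_add_cancel, Real.exp_zero]
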